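/- Let d ≥ 1, M ∈ ℕ, and let σ : ℝ^d → ℂ satisfy ‖∂^α σ‖_{L^∞} ≤ C_M for every multi-index α with |α| ≤ M. Let Ψ(x) = ψ₁(x₁)⋯ψ_d(x_d) be a tensor product of compactly supported bounded measurable functions ψ_i : ℝ → ℝ, at least one of which has vanishing moments of all orders up to M (i.e. ∫_ℝ s^k ψ_i(s) ds = 0 for 0 ≤ k ≤ M). Then there is a constant C depending only on Ψ, d and M such that for every γ ∈ ℕ ∪ {0} and every μ ∈ ℤ^d, |∫_{ℝ^d} σ(x) · 2^{γd/2} Ψ(2^γ x − μ) dx| ≤ C · C_M · 2^{−(M + d/2)γ}. -/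

import Mathlib

open MeasureTheory Filter
open scoped ENNReal NNReal Topology

noncomputable section

/-- A bound on the `m`-th derivative is inherited by composition with an affine map, up to the
`m`-th power of the norm of its linear part. -/
theorem norm_iteratedFDeriv_comp_affine_le {E F G : Type*}
    [NormedAddCommGroup E] [NormedSpace ℝ E] [NormedAddCommGroup F] [NormedSpace ℝ F]
    [NormedAddCommGroup G] [NormedSpace ℝ G] {m : ℕ} {f : E → F} {K : ℝ}
    (hf : ContDiff ℝ m f) (hK : ∀ x, ‖iteratedFDeriv ℝ m f x‖ ≤ K) (L : G →L[ℝ] E) (b : E)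
    (x : G) : ‖iteratedFDeriv ℝ m (fun y => f (L y + b)) x‖ ≤ K * ‖L‖ ^ m := by
  have hg : ContDiff ℝ m (fun z => f (z + b)) := hf.comp (contDiff_id.add contDiff_const)
  have h : (fun y => f (L y + b)) = (fun z => f (z + b)) ∘ L := rfl
  rw [h, L.iteratedFDeriv_comp_right hg x le_rfl]
  refine (ContinuousMultilinearMap.norm_compContinuousLinearMap_le _ _).trans ?_
  rw [Finset.prod_const, Finset.card_univ, Fintype.card_fin, iteratedFDeriv_comp_add_right]
  gcongr
  exact hK _

/-- Taylor's theorem at `0`: a function whose `m`-th derivative is bounded by `K` agrees with some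
polynomial of degree less than `m` up to `K * |t| ^ m`. -/
theorem exists_polynomial_norm_sub_le {E : Type*} [NormedAddCommGroup E] [NormedSpace ℝ E]
    {K : ℝ} (m : ℕ) (f : ℝ → E) (hf : ContDiff ℝ m f) (hK : ∀ t, ‖iteratedDeriv m f t‖ ≤ K) :
    ∃ c : ℕ → E, ∀ t, ‖f t - ∑ k ∈ Finset.range m, t ^ k • c k‖ ≤ K * |t| ^ m := by
  induction m generalizing f with
  | zero => exact ⟨0, fun t => by simpa using hK t⟩
  | succ m ih =>
    have hK0 : 0 ≤ K := (norm_nonneg _).trans (hK 0)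
    have hf' : ContDiff ℝ ((m : WithTop ℕ∞) + 1) f := by exact_mod_cast hf
    obtain ⟨c, hc⟩ := ih (deriv f) (contDiff_succ_iff_deriv.1 hf').2.2 fun t => by
      simpa only [iteratedDeriv_succ'] using hK t
    have hdf : Differentiable ℝ f := (contDiff_succ_iff_deriv.1 hf').1
    let c' : ℕ → E
      | 0 => f 0
      | k + 1 => ((k : ℝ) + 1)⁻¹ • c k
    refine ⟨c', fun t => ?_⟩
    have hder (s : ℝ) : HasDerivAt
        (fun u : ℝ => f u - ∑ k ∈ Finset.range m, u ^ (k + 1) • c' (k + 1))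
        (deriv f s - ∑ k ∈ Finset.range m, s ^ k • c k) s := by
      refine (hdf s).hasDerivAt.sub (HasDerivAt.fun_sum fun k _ => ?_)
      convert (hasDerivAt_pow (k + 1) s).smul_const (c' (k + 1)) using 1
      have hk : (k : ℝ) + 1 ≠ 0 := by positivity
      simp only [c', smul_smul, Nat.add_sub_cancel]
      congr 1
      push_cast
      field_simp
    have hmvt := (convex_Icc (-|t|) |t|).norm_image_sub_le_of_norm_hasDerivWithin_le
      (C := K * |t| ^ m) (x := 0) (y := t) (fun s _ => (hder s).hasDerivWithinAt)
      (fun s hs => (hc s).trans 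
        (mul_le_mul_of_nonneg_left (pow_le_pow_left₀ (abs_nonneg s) (abs_le.2 ⟨hs.1, hs.2⟩) m) hK0))
      ⟨neg_nonpos.2 (abs_nonneg t), abs_nonneg t⟩
      ⟨neg_abs_le t, le_abs_self t⟩
    rw [Finset.sum_range_succ']
    simp only [ne_eq, Nat.add_eq_zero_iff, one_ne_zero, and_false, not_false_eq_true, zero_pow,
      zero_smul, Finset.sum_const_zero, sub_zero, Real.norm_eq_abs] at hmvt
    calc ‖f t - (∑ k ∈ Finset.range m, t ^ (k + 1) • c' (k + 1) + t ^ 0 • c' 0)‖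
        = ‖f t - ∑ k ∈ Finset.range m, t ^ (k + 1) • c' (k + 1) - f 0‖ := by
          simp [c', sub_sub]
      _ ≤ K * |t| ^ m * |t| := hmvt
      _ = K * |t| ^ (m + 1) := by ring

/-- Testing against a function with vanishing moments of order less than `m` is controlled by the
`m`-th derivative. -/
theorem norm_integral_mul_le_of_moments_eq_zero {m : ℕ} {K : ℝ} {f : ℝ → ℂ} {φ : ℝ → ℝ}
    (hf : ContDiff ℝ m f) (hK : ∀ t, ‖iteratedDeriv m f t‖ ≤ K)
    (hφ : ∀ k : ℕ, Integrable fun t => t ^ k * φ t)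
    (hmom : ∀ k < m, ∫ t, t ^ k * φ t = 0) :
    ‖∫ t, f t * (φ t : ℂ)‖ ≤ K * ∫ t, |t| ^ m * |φ t| := by
  have hK0 : 0 ≤ K := (norm_nonneg _).trans (hK 0)
  by_cases hint : Integrable fun t => f t * (φ t : ℂ)
  swap
  · rw [integral_undef hint, norm_zero]
    positivity
  obtain ⟨c, hc⟩ := exists_polynomial_norm_sub_le m f hf hK
  have hterm (k : ℕ) : Integrable fun t : ℝ => c k * ((t ^ k * φ t : ℝ) : ℂ) :=
    (hφ k).ofReal.const_mul (c k)
  have hpoly : ∫ t, ∑ k ∈ Finset.range m, c k * ((t ^ k * φ t : ℝ) : ℂ) = 0 := by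
    rw [integral_finsetSum _ fun k _ => hterm k]
    refine Finset.sum_eq_zero fun k hk => ?_
    rw [integral_const_mul, integral_complex_ofReal, hmom k (Finset.mem_range.1 hk)]
    simp
  have heq : ∫ t, f t * (φ t : ℂ) =
      ∫ t, (f t * (φ t : ℂ) - ∑ k ∈ Finset.range m, c k * ((t ^ k * φ t : ℝ) : ℂ)) := by
    rw [integral_sub hint (integrable_finsetSum _ fun k _ => hterm k), hpoly, sub_zero]
  rw [heq, ← integral_const_mul]
  refine norm_integral_le_of_norm_le ?_ (ae_of_all _ fun t => ?_)
  · simpa [abs_mul, abs_pow] using (hφ m).abs.const_mul K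
  · have : f t * (φ t : ℂ) - ∑ k ∈ Finset.range m, c k * ((t ^ k * φ t : ℝ) : ℂ) =
        (f t - ∑ k ∈ Finset.range m, t ^ k • c k) * (φ t : ℂ) := by
      rw [sub_mul, Finset.sum_mul]
      congr 1
      refine Finset.sum_congr rfl fun k _ => ?_
      rw [Complex.real_smul]
      push_cast
      ring
    rw [this, norm_mul, Complex.norm_real, Real.norm_eq_abs, ← mul_assoc]
    gcongr
    exact hc t

/-- A bounded measurable function with compact support is integrable against every monomial. -/
theorem integrable_pow_mul_of_hasCompactSupport {φ : ℝ → ℝ} (hsupp : HasCompactSupport φ)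
    (hmeas : Measurable φ) {B : ℝ} (hB : ∀ s, |φ s| ≤ B) (k : ℕ) :
    Integrable fun t => t ^ k * φ t := by
  have hφ : IntegrableOn φ (tsupport φ) :=
    Measure.integrableOn_of_bounded hsupp.isCompact.measure_lt_top.ne
      hmeas.aestronglyMeasurable (ae_of_all _ hB)
  rw [← integrableOn_iff_integrable_of_support_subset
    ((Function.support_mul_subset_right _ _).trans (subset_tsupport φ))]
  exact hφ.continuousOn_mul (continuous_pow k).continuousOn hsupp.isCompact

/-- The unit-scale estimate: testing against a tensor product one of whose factors has vanishing
moments of order less than `m` is controlled by the `m`-th derivative. -/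
theorem norm_integral_mul_prod_le {n m : ℕ} {φ : Fin (n + 1) → ℝ → ℝ} {i₀ : Fin (n + 1)}
    (hφ : ∀ i, Integrable (φ i)) (hφ₀ : ∀ k : ℕ, Integrable fun t => t ^ k * φ i₀ t)
    (hmom : ∀ k < m, ∫ t, t ^ k * φ i₀ t = 0)
    {f : EuclideanSpace ℝ (Fin (n + 1)) → ℂ} {K B : ℝ} (hf : ContDiff ℝ m f)
    (hB : ∀ x, ‖f x‖ ≤ B) (hK : ∀ x, ‖iteratedFDeriv ℝ m f x‖ ≤ K) :
    ‖∫ x, f x * ((∏ i, φ i (x i) : ℝ) : ℂ)‖ ≤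
      K * ((∫ t, |t| ^ m * |φ i₀ t|) * ∏ j, ∫ t, |φ (i₀.succAbove j) t|) := by
  let e := MeasurableEquiv.piFinSuccAbove (fun _ : Fin (n + 1) => ℝ) i₀
  have he : MeasurePreserving e.symm :=
    (volume_preserving_piFinSuccAbove (fun _ : Fin (n + 1) => ℝ) i₀).symm
  have hint : Integrable fun x : Fin (n + 1) → ℝ =>
      f (WithLp.toLp 2 x) * ((∏ i, φ i (x i) : ℝ) : ℂ) := by
    refine Integrable.bdd_mul (c := B) (Integrable.fintype_prod hφ).ofReal ?_
      (ae_of_all _ fun x => hB _)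
    exact (hf.continuous.comp (PiLp.continuous_toLp 2 _)).aestronglyMeasurable
  rw [← (PiLp.volume_preserving_toLp (Fin (n + 1))).integral_comp
    (MeasurableEquiv.toLp 2 _).measurableEmbedding, ← he.integral_comp e.symm.measurableEmbedding]
  have hint' := (he.integrable_comp_emb e.symm.measurableEmbedding).2 hint
  rw [Measure.volume_eq_prod] at hint' ⊢
  rw [show (∫ z, f (WithLp.toLp 2 (e.symm z)) * ((∏ i, φ i (e.symm z i) : ℝ) : ℂ)
      ∂(volume.prod volume)) = _ from integral_prod_symm _ hint']
  have hsymm (t : ℝ) (y : Fin n → ℝ) : e.symm (t, y) = i₀.insertNth t y := rfl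
  have hline (y : Fin n → ℝ) (t : ℝ) : WithLp.toLp 2 (e.symm (t, y)) =
      ContinuousLinearMap.toSpanSingleton ℝ (EuclideanSpace.single i₀ (1 : ℝ)) t +
        WithLp.toLp 2 (i₀.insertNth 0 y) := by
    ext i
    refine i₀.succAboveCases ?_ (fun j => ?_) i <;> simp [hsymm]
  have hinner (y : Fin n → ℝ) :
      ‖∫ t, f (WithLp.toLp 2 (e.symm (t, y))) * (φ i₀ t : ℂ)‖ ≤ K * ∫ t, |t| ^ m * |φ i₀ t| := by
    refine norm_integral_mul_le_of_moments_eq_zero ?_ (fun t => ?_) hφ₀ hmom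
    · simp only [hline]
      exact hf.comp ((ContinuousLinearMap.contDiff _).add contDiff_const)
    · simp only [hline]
      rw [← norm_iteratedFDeriv_eq_norm_iteratedDeriv]
      refine (norm_iteratedFDeriv_comp_affine_le hf hK _ _ t).trans_eq ?_
      simp
  have hsplit (y : Fin n → ℝ) (t : ℝ) : (∏ i, φ i (e.symm (t, y) i)) =
      φ i₀ t * ∏ j, φ (i₀.succAbove j) (y j) := by
    simp [Fin.prod_univ_succAbove _ i₀, hsymm]
  have hprod : ∏ j, ∫ t, |φ (i₀.succAbove j) t| =
      ∫ y : Fin n → ℝ, ∏ j, |φ (i₀.succAbove j) (y j)| :=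
    (integral_fintype_prod_volume_eq_prod fun j t => |φ (i₀.succAbove j) t|).symm
  rw [hprod, ← mul_assoc, ← integral_const_mul]
  refine norm_integral_le_of_norm_le ?_ (ae_of_all _ fun y => ?_)
  · exact (Integrable.fintype_prod fun j => (hφ (i₀.succAbove j)).abs).const_mul _
  · simp only [hsplit, Complex.ofReal_mul, ← mul_assoc]
    rw [integral_mul_const, norm_mul, Complex.norm_real, Real.norm_eq_abs, Finset.abs_prod]
    gcongr
    exact hinner y

/-- Lemma 2.4: decay of wavelet coefficients. If all partial derivatives of `σ` up to
order `M` are bounded by `C_M`, and `Ψ = ψ₁ ⊗ ⋯ ⊗ ψ_d` is a tensor product of compactly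
supported bounded measurable functions one of which has vanishing moments up to order `M`,
then `|⟨σ, 2^{γd/2} Ψ(2^γ · - μ)⟩| ≤ C C_M 2^{-(M + d/2)γ}`. -/
theorem wavelet_coefficient_decay
    (d : ℕ) (hd : 1 ≤ d) (M : ℕ) (ψ : Fin d → ℝ → ℝ)
    (hψ_supp : ∀ i, HasCompactSupport (ψ i))
    (hψ_meas : ∀ i, Measurable (ψ i))
    (hψ_bdd : ∀ i, ∃ B : ℝ, ∀ s, |ψ i s| ≤ B)
    (hψ_moments : ∃ i₀, ∀ k : ℕ, k ≤ M → ∫ s : ℝ, s ^ k * ψ i₀ s = 0) :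
    ∃ C : ℝ, 0 < C ∧
      ∀ (σ : EuclideanSpace ℝ (Fin d) → ℂ) (CM : ℝ),
        ContDiff ℝ (M : ℕ∞) σ →
        (∀ k : ℕ, k ≤ M → ∀ x, ‖iteratedFDeriv ℝ k σ x‖ ≤ CM) →
        ∀ (γ : ℕ) (μ : Fin d → ℤ),
          ‖∫ x : EuclideanSpace ℝ (Fin d),
              σ x *
                (((2 : ℝ) ^ ((γ : ℝ) * (d : ℝ) / 2) *
                  ∏ i, ψ i ((2 : ℝ) ^ γ * x i - (μ i : ℝ)) : ℝ) : ℂ)‖ ≤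
            C * CM * 2 ^ (-((M : ℝ) + (d : ℝ) / 2) * (γ : ℝ)) := by
  obtain ⟨n, rfl⟩ : ∃ n, d = n + 1 := ⟨d - 1, by lia⟩
  obtain ⟨i₀, hmom⟩ := hψ_moments
  choose B hB using hψ_bdd
  have hpow (i : Fin (n + 1)) (k : ℕ) : Integrable fun t => t ^ k * ψ i t :=
    integrable_pow_mul_of_hasCompactSupport (hψ_supp i) (hψ_meas i) (hB i) k
  have hint (i : Fin (n + 1)) : Integrable (ψ i) := by simpa using hpow i 0
  set A := (∫ t, |t| ^ M * |ψ i₀ t|) * ∏ j, ∫ t, |ψ (i₀.succAbove j) t|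
  have hA0 : 0 ≤ A := by positivity
  refine ⟨A + 1, by positivity, fun σ CM hσ hσ_bdd γ μ => ?_⟩
  have hCM : 0 ≤ CM := (norm_nonneg _).trans (hσ_bdd 0 (Nat.zero_le M) 0)
  have hσ' : ContDiff ℝ M σ := hσ
  set R : ℝ := 2 ^ γ
  have hR0 : 0 < R := by positivity
  let v : EuclideanSpace ℝ (Fin (n + 1)) := WithLp.toLp 2 fun i => (μ i : ℝ)
  let L : EuclideanSpace ℝ (Fin (n + 1)) →L[ℝ] EuclideanSpace ℝ (Fin (n + 1)) :=
    R⁻¹ • ContinuousLinearMap.id ℝ _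
  let τ : EuclideanSpace ℝ (Fin (n + 1)) → ℂ := fun y => σ (L y + R⁻¹ • v)
  have hL : ‖L‖ = R⁻¹ := by
    simp [L, norm_smul, abs_of_pos hR0]
  have hunit : ‖∫ y, τ y * ((∏ i, ψ i (y i) : ℝ) : ℂ)‖ ≤ CM * R⁻¹ ^ M * A := by
    refine norm_integral_mul_prod_le (B := CM) hint (hpow i₀) (fun k hk => hmom k hk.le) ?_ ?_ ?_
    · exact hσ'.comp (L.contDiff.add contDiff_const)
    · intro y
      simpa using hσ_bdd 0 (Nat.zero_le M) (L y + R⁻¹ • v)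
    · intro y
      rw [← hL]
      exact norm_iteratedFDeriv_comp_affine_le hσ' (hσ_bdd M le_rfl) L _ y
  have hscale : ∫ x : EuclideanSpace ℝ (Fin (n + 1)),
      σ x * ((∏ i, ψ i (R * x i - (μ i : ℝ)) : ℝ) : ℂ) =
        (R ^ (n + 1))⁻¹ • ∫ y, τ y * ((∏ i, ψ i (y i) : ℝ) : ℂ) := by
    have h := Measure.integral_comp_smul_of_nonneg volume
      (fun y => τ (y - v) * ((∏ i, ψ i ((y - v) i) : ℝ) : ℂ)) R (hR := hR0.le)
    rw [finrank_euclideanSpace_fin,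
      integral_sub_right_eq_self (fun y => τ y * ((∏ i, ψ i (y i) : ℝ) : ℂ)) v] at h
    rw [← h]
    refine integral_congr_ae (ae_of_all _ fun x => ?_)
    have hx : L (R • x - v) + R⁻¹ • v = x := by
      simp [L, smul_sub, smul_smul, hR0.ne']
    simp only [τ, hx]
    simp [v]
  have hexp : (2 : ℝ) ^ ((γ : ℝ) * ((n + 1 : ℕ) : ℝ) / 2) * ((R ^ (n + 1))⁻¹ * R⁻¹ ^ M) =
      2 ^ (-((M : ℝ) + ((n + 1 : ℕ) : ℝ) / 2) * (γ : ℝ)) := by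
    have h2 : (R ^ (n + 1))⁻¹ * R⁻¹ ^ M = (2 : ℝ) ^ (-((γ : ℝ) * ((n + 1 + M : ℕ) : ℝ))) := by
      rw [Real.rpow_neg zero_le_two, Real.rpow_mul zero_le_two, Real.rpow_natCast,
        Real.rpow_natCast, inv_pow, ← mul_inv, ← pow_add]
    rw [h2, ← Real.rpow_add two_pos]
    congr 1
    push_cast
    ring
  calc _ = ‖(((2 : ℝ) ^ ((γ : ℝ) * ((n + 1 : ℕ) : ℝ) / 2) : ℝ) : ℂ) *
        ∫ x : EuclideanSpace ℝ (Fin (n + 1)),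
          σ x * ((∏ i, ψ i (R * x i - (μ i : ℝ)) : ℝ) : ℂ)‖ := by
        rw [← integral_const_mul]
        congr 2 with x
        rw [Complex.ofReal_mul, mul_left_comm]
    _ = (2 : ℝ) ^ ((γ : ℝ) * ((n + 1 : ℕ) : ℝ) / 2) * ((R ^ (n + 1))⁻¹ *
        ‖∫ y, τ y * ((∏ i, ψ i (y i) : ℝ) : ℂ)‖) := by
        rw [hscale, norm_mul, norm_smul, Complex.norm_real, Real.norm_of_nonneg (by positivity),
          Real.norm_of_nonneg (by positivity)]
    _ ≤ (2 : ℝ) ^ ((γ : ℝ) * ((n + 1 : ℕ) : ℝ) / 2) * ((R ^ (n + 1))⁻¹ *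
        (CM * R⁻¹ ^ M * (A + 1))) := by
        gcongr
        exact hunit.trans (by gcongr; linarith)
    _ = _ := by
        rw [← hexp]
        ring
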